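/- arXiv:1306.6257 — 4 statements merged into one kernel-verified Lean document; each statement's English description precedes it below -/
import Mathlib

section
/- For every complex number α with Re(α) < 1, the double integral ∫₀^∞ ∫₀^∞ x^(−α) e^(−(x+y)²/4) dx dy converges and equals 2^(1−α) Γ((2−α)/2) / (1−α). -/
open MeasureTheory Set

lemma norm_cpow_mul_exp_neg_add_sq_le (α : ℂ) {x y : ℝ} (hx : 0 < x) (hy : 0 < y) :
    ‖(x : ℂ) ^ (-α) * Complex.exp (-(((x : ℂ) + (y : ℂ)) ^ 2 / 4))‖ ≤
      (x ^ (-α.re) * Real.exp (-(1 / 4) * x ^ 2)) * Real.exp (-(1 / 4) * y ^ 2) := by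
  rw [norm_mul, Complex.norm_cpow_eq_rpow_re_of_pos hx, Complex.norm_exp, mul_assoc,
    ← Real.exp_add, Complex.neg_re]
  have h : (-(((x : ℂ) + (y : ℂ)) ^ 2 / 4)).re = -((x + y) ^ 2 / 4) := by
    rw [show -(((x : ℂ) + (y : ℂ)) ^ 2 / 4) = ((-((x + y) ^ 2 / 4) : ℝ) : ℂ) by push_cast; ring,
      Complex.ofReal_re]
  rw [h]
  gcongr
  nlinarith [mul_pos hx hy]

lemma integrableOn_cpow_mul_exp_neg_add_sq {α : ℂ} (hα : α.re < 1) :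
    IntegrableOn
      (fun q : ℝ × ℝ => (q.1 : ℂ) ^ (-α) * Complex.exp (-(((q.1 : ℂ) + (q.2 : ℂ)) ^ 2 / 4)))
      (Ioi (0 : ℝ) ×ˢ Ioi (0 : ℝ)) volume := by
  have hx := integrableOn_rpow_mul_exp_neg_mul_sq (b := 1 / 4) (by norm_num)
    (s := -α.re) (by linarith)
  have hy : IntegrableOn (fun y : ℝ => Real.exp (-(1 / 4) * y ^ 2)) (Ioi 0) :=
    (integrable_exp_neg_mul_sq (by norm_num)).integrableOn
  have hxy := hx.integrable.mul_prod hy.integrable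
  rw [Measure.prod_restrict, ← Measure.volume_eq_prod] at hxy
  refine hxy.mono' (Measurable.aestronglyMeasurable (by fun_prop)) ?_
  filter_upwards [ae_restrict_mem (measurableSet_Ioi.prod measurableSet_Ioi)] with q hq
  exact norm_cpow_mul_exp_neg_add_sq_le α hq.1 hq.2

lemma integral_cpow_mul_exp_neg_sq_div_four {α : ℂ} (hα : α.re < 2) :
    ∫ u in Ioi (0 : ℝ), (u : ℂ) ^ (1 - α) * Complex.exp (-((u : ℂ) ^ 2 / 4)) =
      2 ^ (1 - α) * Complex.Gamma ((2 - α) / 2) := by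
  have ha : 0 < ((2 - α) / 2).re := by
    simp; linarith
  have h := Complex.integral_cpow_mul_exp_neg_mul_Ioi (r := 1 / 4) ha (by norm_num)
  rw [← integral_comp_rpow_Ioi_of_pos (p := 2) (by norm_num)] at h
  have hpow : (1 / ((1 / 4 : ℝ) : ℂ)) ^ ((2 - α) / 2) = 2 * 2 ^ (1 - α) := by
    rw [show (1 / ((1 / 4 : ℝ) : ℂ)) = ((2 : ℝ) : ℂ) * ((2 : ℝ) : ℂ) by push_cast; norm_num,
      Complex.mul_cpow_ofReal_nonneg (by norm_num) (by norm_num),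
      ← Complex.cpow_add _ _ (by norm_num),
      show (2 - α) / 2 + (2 - α) / 2 = 1 + (1 - α) by ring,
      Complex.cpow_add _ _ (by norm_num), Complex.cpow_one]
    norm_num
  rw [hpow, mul_assoc] at h
  apply mul_left_cancel₀ (two_ne_zero (α := ℂ))
  rw [← h, ← integral_const_mul]
  refine setIntegral_congr_fun measurableSet_Ioi fun u hu => ?_
  have hu : 0 < u := hu
  have hu' : (u : ℂ) ≠ 0 := by exact_mod_cast hu.ne'
  have hsq : ((u ^ (2 : ℝ) : ℝ) : ℂ) ^ ((2 - α) / 2 - 1) = (u : ℂ) ^ (-α) := by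
    rw [Real.rpow_two, sq, Complex.ofReal_mul, Complex.mul_cpow_ofReal_nonneg hu.le hu.le,
      ← Complex.cpow_add _ _ hu']
    congr 1; ring
  simp only [hsq]
  rw [sub_eq_add_neg, Complex.cpow_add _ _ hu', Complex.cpow_one, Complex.real_smul,
    show (2 : ℝ) - 1 = 1 by norm_num, Real.rpow_one, Real.rpow_two,
    show -(((1 / 4 : ℝ) : ℂ) * ((u ^ 2 : ℝ) : ℂ)) = -((u : ℂ) ^ 2 / 4) by push_cast; ring]
  push_cast
  ring

/-- The shear `(x, y) ↦ (x, x + y)` turns an integral over the open quadrant into an iterated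
integral over the triangles `0 < x < u`. -/
lemma setIntegral_quadrant_eq_integral_Ioo {E : Type*} [NormedAddCommGroup E] [NormedSpace ℝ E]
    {g : ℝ → ℝ → E}
    (hg : IntegrableOn (fun q : ℝ × ℝ => g q.1 (q.1 + q.2)) (Ioi 0 ×ˢ Ioi 0)) :
    ∫ q in Ioi (0 : ℝ) ×ˢ Ioi (0 : ℝ), g q.1 (q.1 + q.2) =
      ∫ u in Ioi (0 : ℝ), ∫ x in Ioo 0 u, g x u := by
  let T : Set (ℝ × ℝ) := {p | 0 < p.1 ∧ p.1 < p.2}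
  have hT : MeasurableSet T :=
    (measurableSet_lt measurable_const measurable_fst).inter
      (measurableSet_lt measurable_fst measurable_snd)
  have hmp : MeasurePreserving (MeasurableEquiv.shearAddRight ℝ) (volume : Measure (ℝ × ℝ))
      volume := measurePreserving_prod_add volume volume
  have hpre : MeasurableEquiv.shearAddRight ℝ ⁻¹' T = Ioi 0 ×ˢ Ioi 0 := by
    ext ⟨x, y⟩
    simp [T, MeasurableEquiv.shearAddRight]
  have hemb := (MeasurableEquiv.shearAddRight ℝ).measurableEmbedding
  have hint : IntegrableOn (fun p : ℝ × ℝ => g p.1 p.2) T := by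
    rw [← hmp.integrableOn_comp_preimage hemb, hpre]
    exact hg
  have heq := hmp.setIntegral_preimage_emb hemb (fun p : ℝ × ℝ => g p.1 p.2) T
  rw [hpre] at heq
  refine heq.trans ?_
  rw [← integral_indicator hT, Measure.volume_eq_prod, integral_prod_symm _
    (by rw [← Measure.volume_eq_prod]; exact hint.integrable_indicator hT),
    ← integral_indicator measurableSet_Ioi]
  congr 1 with u
  by_cases hu : 0 < u
  · rw [indicator_of_mem (mem_Ioi.2 hu), ← integral_indicator measurableSet_Ioo]
    rfl
  · rw [indicator_of_notMem (by simpa using hu)]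
    refine integral_eq_zero_of_ae (.of_forall fun x => indicator_of_notMem ?_ _)
    exact fun h => hu (h.1.trans h.2)

/-- The coefficient integral defining `ε₀,α` in Section 3.2 of the paper. -/
theorem stmt1 (α : ℂ) (hα : α.re < 1) :
    IntegrableOn
      (fun q : ℝ × ℝ => (q.1 : ℂ) ^ (-α) * Complex.exp (-(((q.1 : ℂ) + (q.2 : ℂ)) ^ 2 / 4)))
      (Ioi (0 : ℝ) ×ˢ Ioi (0 : ℝ)) volume ∧
    ∫ q in Ioi (0 : ℝ) ×ˢ Ioi (0 : ℝ),
        (q.1 : ℂ) ^ (-α) * Complex.exp (-(((q.1 : ℂ) + (q.2 : ℂ)) ^ 2 / 4))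
      = 2 ^ (1 - α) * Complex.Gamma ((2 - α) / 2) / (1 - α) := by
  have hint := integrableOn_cpow_mul_exp_neg_add_sq hα
  refine ⟨hint, ?_⟩
  have h1α : 1 - α ≠ 0 := fun h => by
    have := congrArg Complex.re h
    simp at this
    linarith
  have hshear := setIntegral_quadrant_eq_integral_Ioo
    (g := fun x u => (x : ℂ) ^ (-α) * Complex.exp (-((u : ℂ) ^ 2 / 4)))
    (by simpa only [Complex.ofReal_add] using hint)
  simp only [Complex.ofReal_add] at hshear
  rw [hshear, ← integral_cpow_mul_exp_neg_sq_div_four (by linarith), ← integral_div]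
  refine setIntegral_congr_fun measurableSet_Ioi fun u hu => ?_
  have hu : 0 < u := hu
  rw [integral_mul_const, ← integral_Ioc_eq_integral_Ioo,
    ← intervalIntegral.integral_of_le hu.le, integral_cpow (Or.inl (by simpa using hα)),
    neg_add_eq_sub, Complex.ofReal_zero, Complex.zero_cpow h1α, sub_zero]
  ring
end

section
/- For every complex number α with Re(α) < 1, the double integral ∫₀^∞ ∫₀^∞ x^(−α) · y · e^(−(x+y)²/4) dx dy converges and equals 2^(1−α) Γ((1−α)/2) / (2−α). -/
open MeasureTheory Set

/-- The Gaussian `exp (-(x + y)² / 4)`, with complex values. -/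
noncomputable def sumGaussian (x y : ℝ) : ℂ := Complex.exp (-(((x : ℂ) + (y : ℂ)) ^ 2 / 4))

lemma sumGaussian_comm (x y : ℝ) : sumGaussian x y = sumGaussian y x := by
  simp only [sumGaussian, add_comm]

lemma continuous_sumGaussian : Continuous fun q : ℝ × ℝ => sumGaussian q.1 q.2 := by
  unfold sumGaussian
  fun_prop

lemma norm_sumGaussian_le {x y : ℝ} (hx : 0 ≤ x) (hy : 0 ≤ y) :
    ‖sumGaussian x y‖ ≤ Real.exp (-(1 / 4) * x ^ 2) * Real.exp (-(1 / 4) * y ^ 2) := by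
  have h : (-(((x : ℂ) + (y : ℂ)) ^ 2 / 4)) = ((-((x + y) ^ 2 / 4) : ℝ) : ℂ) := by push_cast; ring
  rw [sumGaussian, h, Complex.norm_exp_ofReal, ← Real.exp_add, Real.exp_le_exp]
  nlinarith [mul_nonneg hx hy]

lemma hasDerivAt_sumGaussian_left (x y : ℝ) :
    HasDerivAt (fun x => sumGaussian x y) (-(((x : ℂ) + y) / 2) * sumGaussian x y) x := by
  have h : HasDerivAt (fun x : ℝ => -(((x : ℂ) + (y : ℂ)) ^ 2 / 4)) (-(((x : ℂ) + y) / 2)) x := by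
    convert! ((((hasDerivAt_id x).ofReal_comp.add_const (y : ℂ)).pow 2).div_const 4).neg using 1
    simp
    ring
  rw [mul_comm]
  exact h.cexp

lemma hasDerivAt_sumGaussian_right (x y : ℝ) :
    HasDerivAt (fun y => sumGaussian x y) (-(((x : ℂ) + y) / 2) * sumGaussian x y) y := by
  simpa only [sumGaussian_comm x, add_comm (x : ℂ)] using hasDerivAt_sumGaussian_left y x

lemma aestronglyMeasurable_ofReal_cpow (β : ℂ) :
    AEStronglyMeasurable (fun x : ℝ => (x : ℂ) ^ β) (volume.restrict (Ioi 0)) := by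
  refine ContinuousOn.aestronglyMeasurable (fun x hx => ?_) measurableSet_Ioi
  exact (Complex.continuousAt_ofReal_cpow_const x β (Or.inr hx.out.ne')).continuousWithinAt

lemma integrableOn_cpow_mul_sumGaussian {β : ℂ} (hβ : -1 < β.re) {y : ℝ} (hy : 0 ≤ y) :
    IntegrableOn (fun x : ℝ => (x : ℂ) ^ β * sumGaussian x y) (Ioi 0) := by
  have hc : Continuous fun x : ℝ => sumGaussian x y :=
    continuous_iff_continuousAt.mpr fun x => (hasDerivAt_sumGaussian_left x y).continuousAt
  refine Integrable.mono' (integrableOn_rpow_mul_exp_neg_mul_sq (b := 1 / 4) (by norm_num) hβ)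
    ((aestronglyMeasurable_ofReal_cpow β).mul hc.aestronglyMeasurable)
    (ae_restrict_of_forall_mem measurableSet_Ioi fun x hx => ?_)
  have hx : 0 < x := hx
  rw [norm_mul, Complex.norm_cpow_eq_rpow_re_of_pos hx]
  gcongr
  refine (norm_sumGaussian_le hx.le hy).trans (mul_le_of_le_one_right (Real.exp_pos _).le ?_)
  exact Real.exp_le_one_iff.mpr (by nlinarith [sq_nonneg y])

lemma integrable_cpow_mul_cpow_mul_sumGaussian {β γ : ℂ} (hβ : -1 < β.re) (hγ : -1 < γ.re) :
    Integrable (fun q : ℝ × ℝ => (q.1 : ℂ) ^ β * (q.2 : ℂ) ^ γ * sumGaussian q.1 q.2)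
      ((volume.restrict (Ioi 0)).prod (volume.restrict (Ioi 0))) := by
  refine Integrable.mono'
    ((integrableOn_rpow_mul_exp_neg_mul_sq (b := 1 / 4) (by norm_num) hβ).mul_prod
      (integrableOn_rpow_mul_exp_neg_mul_sq (b := 1 / 4) (by norm_num) hγ))
    (((aestronglyMeasurable_ofReal_cpow β).comp_fst.mul
      (aestronglyMeasurable_ofReal_cpow γ).comp_snd).mul
        continuous_sumGaussian.aestronglyMeasurable) ?_
  rw [Measure.prod_restrict]
  refine ae_restrict_of_forall_mem (measurableSet_Ioi.prod measurableSet_Ioi) fun q hq => ?_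
  have hx : 0 < q.1 := hq.1
  have hy : 0 < q.2 := hq.2
  rw [norm_mul, norm_mul, Complex.norm_cpow_eq_rpow_re_of_pos hx,
    Complex.norm_cpow_eq_rpow_re_of_pos hy, mul_mul_mul_comm]
  gcongr
  exact norm_sumGaussian_le hx.le hy.le

lemma integral_cpow_mul_sumGaussian_zero {s : ℂ} (hs : 0 < s.re) :
    ∫ x : ℝ in Ioi 0, (x : ℂ) ^ (s - 1) * sumGaussian x 0 =
      2 ^ (s - 1) * Complex.Gamma (s / 2) := by
  have h := mellin_comp_rpow (fun t : ℝ => Complex.exp (-(((1 / 4 : ℝ) : ℂ) * t))) s 2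
  have hs2 : 0 < (s / 2).re := by simpa using hs
  have hg := Complex.integral_cpow_mul_exp_neg_mul_Ioi hs2 (r := 1 / 4) (by norm_num)
  simp only [mellin, smul_eq_mul, Complex.ofReal_ofNat] at h
  rw [hg] at h
  have h4 : (1 / ((1 / 4 : ℝ) : ℂ)) ^ (s / 2) = 2 ^ s := by
    have : (1 / ((1 / 4 : ℝ) : ℂ)) = ((2 : ℝ) : ℂ) * ((2 : ℝ) : ℂ) := by norm_num
    rw [this, Complex.mul_cpow_ofReal_nonneg (by norm_num) (by norm_num),
      ← Complex.cpow_add _ _ (by norm_num), add_halves, Complex.ofReal_ofNat]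
  rw [h4] at h
  calc _ = _ := by
        refine setIntegral_congr_fun measurableSet_Ioi fun x _ => ?_
        simp only [sumGaussian]
        congr 2
        push_cast
        norm_num
        ring
    _ = _ := h
    _ = _ := by
        rw [Complex.cpow_sub _ _ two_ne_zero, Complex.cpow_one]
        simp
        ring

lemma integral_add_mul_sumGaussian {x : ℝ} (hx : 0 ≤ x) :
    ∫ y : ℝ in Ioi 0, ((x : ℂ) + y) * sumGaussian x y = 2 * sumGaussian x 0 := by
  have h0 : IntegrableOn (fun y : ℝ => sumGaussian x y) (Ioi 0) := by
    simpa [sumGaussian_comm x] using integrableOn_cpow_mul_sumGaussian (β := 0) (by simp) hx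
  have h1 : IntegrableOn (fun y : ℝ => (y : ℂ) * sumGaussian x y) (Ioi 0) := by
    simpa [sumGaussian_comm x] using integrableOn_cpow_mul_sumGaussian (β := 1) (by simp) hx
  have h' : IntegrableOn (fun y : ℝ => ((x : ℂ) + y) * sumGaussian x y) (Ioi 0) := by
    simp only [add_mul]
    exact (h0.const_mul (x : ℂ)).add h1
  have hd (y : ℝ) : HasDerivAt (fun y => -2 * sumGaussian x y)
      (((x : ℂ) + y) * sumGaussian x y) y := by
    convert! (hasDerivAt_sumGaussian_right x y).const_mul (-2 : ℂ) using 1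
    ring
  rw [integral_Ioi_of_hasDerivAt_of_tendsto' (fun y _ => hd y) h'
    (tendsto_zero_of_hasDerivAt_of_integrableOn_Ioi (fun y _ => hd y) h' (h0.const_mul _))]
  ring

lemma integral_cpow_mul_add_mul_sumGaussian {β : ℂ} {y : ℝ} (hβ : 0 < β.re) (hy : 0 ≤ y) :
    ∫ x : ℝ in Ioi 0, (β * ((x : ℂ) ^ (β - 1) * sumGaussian x y) -
      (x : ℂ) ^ β * (((x : ℂ) + y) / 2 * sumGaussian x y)) = 0 := by
  have h0 := integrableOn_cpow_mul_sumGaussian (β := β) (by linarith) hy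
  have h1 := integrableOn_cpow_mul_sumGaussian (β := β + 1) (by simp; linarith) hy
  have h2 := integrableOn_cpow_mul_sumGaussian (β := β - 1) (by simpa using hβ) hy
  have hβ0 : β ≠ 0 := by rintro rfl; simp at hβ
  have h' : IntegrableOn (fun x : ℝ => β * ((x : ℂ) ^ (β - 1) * sumGaussian x y) -
      (x : ℂ) ^ β * (((x : ℂ) + y) / 2 * sumGaussian x y)) (Ioi 0) := by
    refine IntegrableOn.congr_fun (f := fun x : ℝ => β * ((x : ℂ) ^ (β - 1) * sumGaussian x y) -
      1 / 2 * ((x : ℂ) ^ (β + 1) * sumGaussian x y + y * ((x : ℂ) ^ β * sumGaussian x y)))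
      ((h2.const_mul β).sub ((h1.add (h0.const_mul (y : ℂ))).const_mul (1 / 2)))
      (fun x hx => ?_) measurableSet_Ioi
    have hx : (x : ℂ) ≠ 0 := by exact_mod_cast hx.out.ne'
    simp only [Complex.cpow_add _ _ hx, Complex.cpow_one]
    ring
  have hd : ∀ x ∈ Ioi (0 : ℝ), HasDerivAt (fun x : ℝ => (x : ℂ) ^ β * sumGaussian x y)
      (β * ((x : ℂ) ^ (β - 1) * sumGaussian x y) -
        (x : ℂ) ^ β * (((x : ℂ) + y) / 2 * sumGaussian x y)) x := by
    intro x hx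
    convert! (hasDerivAt_ofReal_cpow_const hx.out.ne' hβ0).mul
      (hasDerivAt_sumGaussian_left x y) using 1
    ring
  have hc : ContinuousWithinAt (fun x : ℝ => (x : ℂ) ^ β * sumGaussian x y) (Ici 0) 0 :=
    ((Complex.continuousAt_ofReal_cpow_const 0 β (Or.inl hβ)).mul
      (hasDerivAt_sumGaussian_left 0 y).continuousAt).continuousWithinAt
  rw [integral_Ioi_of_hasDerivAt_of_tendsto hc hd h'
    (tendsto_zero_of_hasDerivAt_of_integrableOn_Ioi hd h' h0)]
  simp [hβ0]

lemma integrable_cpow_mul_add_mul_sumGaussian {β : ℂ} (hβ : -1 < β.re) :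
    Integrable (fun q : ℝ × ℝ => (q.1 : ℂ) ^ β * (((q.1 : ℂ) + q.2) * sumGaussian q.1 q.2))
      ((volume.restrict (Ioi 0)).prod (volume.restrict (Ioi 0))) := by
  have h0 := integrable_cpow_mul_cpow_mul_sumGaussian (β := β + 1) (γ := 0)
    (by simp; linarith) (by simp)
  have h1 := integrable_cpow_mul_cpow_mul_sumGaussian (γ := 1) hβ (by simp)
  refine (h0.add h1).congr ?_
  rw [Measure.prod_restrict]
  refine ae_restrict_of_forall_mem (measurableSet_Ioi.prod measurableSet_Ioi) fun q hq => ?_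
  have hx : (q.1 : ℂ) ≠ 0 := by exact_mod_cast hq.1.out.ne'
  simp only [Pi.add_apply, Complex.cpow_add _ _ hx, Complex.cpow_one, Complex.cpow_zero]
  ring

lemma integral_prod_cpow_mul_add_mul_sumGaussian {β : ℂ} (hβ : -1 < β.re) :
    ∫ q : ℝ × ℝ, (q.1 : ℂ) ^ β * (((q.1 : ℂ) + q.2) * sumGaussian q.1 q.2)
      ∂((volume.restrict (Ioi 0)).prod (volume.restrict (Ioi 0))) =
      2 ^ (β + 1) * Complex.Gamma ((β + 1) / 2) := by
  have hs := integral_cpow_mul_sumGaussian_zero (s := β + 1) (by simp; linarith)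
  rw [integral_prod _ (integrable_cpow_mul_add_mul_sumGaussian hβ)]
  calc _ = ∫ x : ℝ in Ioi 0, 2 * ((x : ℂ) ^ β * sumGaussian x 0) := by
        refine setIntegral_congr_fun measurableSet_Ioi fun x hx => ?_
        simp only [integral_const_mul, integral_add_mul_sumGaussian hx.out.le]
        ring
    _ = _ := by
        rw [add_sub_cancel_right] at hs
        rw [integral_const_mul, hs, Complex.cpow_add _ _ two_ne_zero, Complex.cpow_one]
        ring

lemma integral_prod_cpow_sub_one_mul_sumGaussian {β : ℂ} (hβ : 0 < β.re) :
    β * ∫ q : ℝ × ℝ, (q.1 : ℂ) ^ (β - 1) * sumGaussian q.1 q.2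
      ∂((volume.restrict (Ioi 0)).prod (volume.restrict (Ioi 0))) =
      2 ^ β * Complex.Gamma ((β + 1) / 2) := by
  have h0 : Integrable (fun q : ℝ × ℝ => (q.1 : ℂ) ^ (β - 1) * sumGaussian q.1 q.2)
      ((volume.restrict (Ioi 0)).prod (volume.restrict (Ioi 0))) := by
    simpa using integrable_cpow_mul_cpow_mul_sumGaussian (β := β - 1) (γ := 0)
      (by simpa using hβ) (by simp)
  have h1 := integrable_cpow_mul_add_mul_sumGaussian (β := β) (by linarith)
  have hi := integral_prod_cpow_mul_add_mul_sumGaussian (β := β) (by linarith)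
  have hz : ∫ q : ℝ × ℝ, (β * ((q.1 : ℂ) ^ (β - 1) * sumGaussian q.1 q.2) -
      1 / 2 * ((q.1 : ℂ) ^ β * (((q.1 : ℂ) + q.2) * sumGaussian q.1 q.2)))
      ∂((volume.restrict (Ioi 0)).prod (volume.restrict (Ioi 0))) = 0 := by
    refine (integral_prod_symm _ ((h0.const_mul β).sub (h1.const_mul (1 / 2)))).trans ?_
    refine setIntegral_eq_zero_of_forall_eq_zero fun y hy => ?_
    rw [← integral_cpow_mul_add_mul_sumGaussian hβ hy.out.le]
    congr 1 with x
    simp only [Pi.sub_apply]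
    ring
  rw [integral_sub (h0.const_mul β) (h1.const_mul (1 / 2)), integral_const_mul,
    integral_const_mul, hi, Complex.cpow_add _ _ two_ne_zero, Complex.cpow_one] at hz
  linear_combination hz

/-- The coefficient integral defining `ε₃,α` in Section 3.2 of the paper. -/
theorem stmt3 (α : ℂ) (hα : α.re < 1) :
    IntegrableOn
      (fun q : ℝ × ℝ =>
        (q.1 : ℂ) ^ (-α) * (q.2 : ℂ) * Complex.exp (-(((q.1 : ℂ) + (q.2 : ℂ)) ^ 2 / 4)))
      (Ioi (0 : ℝ) ×ˢ Ioi (0 : ℝ)) volume ∧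
    ∫ q in Ioi (0 : ℝ) ×ˢ Ioi (0 : ℝ),
        (q.1 : ℂ) ^ (-α) * (q.2 : ℂ) * Complex.exp (-(((q.1 : ℂ) + (q.2 : ℂ)) ^ 2 / 4))
      = 2 ^ (1 - α) * Complex.Gamma ((1 - α) / 2) / (2 - α) := by
  have hα' : -1 < (-α).re := by simpa using hα
  have h0 : Integrable (fun q : ℝ × ℝ => (q.1 : ℂ) ^ (1 - α) * sumGaussian q.1 q.2)
      ((volume.restrict (Ioi 0)).prod (volume.restrict (Ioi 0))) := by
    simpa using integrable_cpow_mul_cpow_mul_sumGaussian (β := 1 - α) (γ := 0)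
      (by simp; linarith) (by simp)
  have h1 : Integrable (fun q : ℝ × ℝ => (q.1 : ℂ) ^ (-α) * (q.2 : ℂ) * sumGaussian q.1 q.2)
      ((volume.restrict (Ioi 0)).prod (volume.restrict (Ioi 0))) := by
    simpa using integrable_cpow_mul_cpow_mul_sumGaussian (γ := 1) hα' (by simp)
  have hsum := integral_prod_cpow_mul_add_mul_sumGaussian hα'
  have hparts := integral_prod_cpow_sub_one_mul_sumGaussian (β := 2 - α) (by simp; linarith)
  have hadd : ∫ q : ℝ × ℝ, (q.1 : ℂ) ^ (-α) * (((q.1 : ℂ) + q.2) * sumGaussian q.1 q.2)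
      ∂((volume.restrict (Ioi 0)).prod (volume.restrict (Ioi 0))) =
      ∫ q : ℝ × ℝ, ((q.1 : ℂ) ^ (1 - α) * sumGaussian q.1 q.2 +
        (q.1 : ℂ) ^ (-α) * (q.2 : ℂ) * sumGaussian q.1 q.2)
      ∂((volume.restrict (Ioi 0)).prod (volume.restrict (Ioi 0))) := by
    rw [Measure.prod_restrict]
    refine setIntegral_congr_fun (measurableSet_Ioi.prod measurableSet_Ioi) fun q hq => ?_
    have hx : (q.1 : ℂ) ≠ 0 := by exact_mod_cast hq.1.out.ne'
    simp only [sub_eq_add_neg, Complex.cpow_add _ _ hx, Complex.cpow_one]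
    ring
  rw [integral_add h0 h1, hsum] at hadd
  rw [show 2 - α - 1 = 1 - α by ring, show (2 - α + 1) / 2 = (1 - α) / 2 + 1 by ring,
    Complex.Gamma_add_one _ (fun h => by
      have := congrArg Complex.re h
      simp at this
      linarith), show 2 - α = 1 + (1 - α) by ring, Complex.cpow_add _ _ two_ne_zero,
    Complex.cpow_one] at hparts
  rw [neg_add_eq_sub] at hadd
  rw [Measure.prod_restrict, ← Measure.volume_eq_prod] at h1 hadd hparts
  refine ⟨h1, ?_⟩
  have h2 : 2 - α ≠ 0 := fun h => by
    have := congrArg Complex.re h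
    simp at this
    linarith
  rw [eq_div_iff h2]
  simp only [sumGaussian] at hadd hparts
  linear_combination (α - 2) * hadd - hparts
end

section
/- For every complex number α with Re(α) < 1, the double integral ∫₀^∞ ∫₀^∞ x^(1−α) · y · e^(−(x+y)²/4) dx dy converges and equals 2^(2−α) Γ((2−α)/2) / (3−α). -/
open MeasureTheory Set

/-- Integration over the open positive quadrant along the lines `x + y = r`. -/
theorem setIntegral_quadrant_eq_integral_add {E : Type*} [NormedAddCommGroup E] [NormedSpace ℝ E]
    {F : ℝ × ℝ → E} (hF : IntegrableOn F (Ioi (0 : ℝ) ×ˢ Ioi (0 : ℝ)) volume) :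
    ∫ q in Ioi (0 : ℝ) ×ˢ Ioi (0 : ℝ), F q =
      ∫ r in Ioi (0 : ℝ), ∫ x in (0 : ℝ)..r, F (x, r - x) := by
  have hS : MeasurableSet (Ioi (0 : ℝ) ×ˢ Ioi (0 : ℝ)) := measurableSet_Ioi.prod measurableSet_Ioi
  have hmp : MeasurePreserving (fun z : ℝ × ℝ => (z.2, z.1 - z.2)) volume volume :=
    measurePreserving_prod_sub_swap volume volume
  have hG := (integrable_indicator_iff hS).2 hF
  set G := (Ioi (0 : ℝ) ×ˢ Ioi (0 : ℝ)).indicator F with hGdef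
  have hG' : Integrable (fun z : ℝ × ℝ => G (z.2, z.1 - z.2)) (volume.prod volume) :=
    (hmp.integrable_comp hG.aestronglyMeasurable).2 hG
  have hmap : ∫ q, G q = ∫ z : ℝ × ℝ, G (z.2, z.1 - z.2) := by
    conv_lhs => rw [← hmp.map_eq]
    refine integral_map hmp.aemeasurable ?_
    rw [hmp.map_eq]
    exact hG.aestronglyMeasurable
  have hslice (r : ℝ) : (fun x => G (x, r - x)) = (Ioo 0 r).indicator fun x => F (x, r - x) := by
    ext x
    simp [hGdef, indicator_apply]
  rw [← integral_indicator hS, hmap, Measure.volume_eq_prod, integral_prod _ hG',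
    ← integral_indicator measurableSet_Ioi]
  congr 1 with r
  simp only [hslice, integral_indicator measurableSet_Ioo]
  by_cases hr : 0 < r
  · rw [indicator_of_mem (mem_Ioi.2 hr), intervalIntegral.integral_of_le hr.le,
      integral_Ioc_eq_integral_Ioo]
  · rw [indicator_of_notMem (by simpa using hr), Ioo_eq_empty hr, setIntegral_empty]

/-- The moments of the Gaussian `exp (-r ^ 2 / 4)` on the positive half-line. -/
theorem integral_cpow_mul_cexp_neg_sq_div_four {s : ℂ} (hs : -1 < s.re) :
    ∫ r in Ioi (0 : ℝ), (r : ℂ) ^ s * Complex.exp (-((r : ℂ) ^ 2 / 4)) =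
      2 ^ s * Complex.Gamma ((s + 1) / 2) := by
  have ha : 0 < ((s + 1) / 2).re := by
    simp only [Complex.div_ofNat_re, Complex.add_re, Complex.one_re]
    linarith
  have hΓ := Complex.integral_cpow_mul_exp_neg_mul_Ioi ha (r := 1 / 4) (by norm_num)
  rw [← integral_comp_rpow_Ioi_of_pos (p := 2) two_pos] at hΓ
  have hfun : ∀ r ∈ Ioi (0 : ℝ),
      (2 * r ^ ((2 : ℝ) - 1)) • (((r ^ (2 : ℝ) : ℝ) : ℂ) ^ ((s + 1) / 2 - 1) *
        Complex.exp (-(((1 / 4 : ℝ) : ℂ) * ((r ^ (2 : ℝ) : ℝ) : ℂ)))) =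
      2 * ((r : ℂ) ^ s * Complex.exp (-((r : ℂ) ^ 2 / 4))) := by
    intro r hr
    have hr0 : (r : ℂ) ≠ 0 := Complex.ofReal_ne_zero.2 (ne_of_gt hr)
    have hpow : ((r ^ (2 : ℝ) : ℝ) : ℂ) ^ ((s + 1) / 2 - 1) = (r : ℂ) ^ (s - 1) := by
      rw [Real.rpow_two, pow_two, Complex.ofReal_mul,
        Complex.mul_cpow_ofReal_nonneg (le_of_lt hr) (le_of_lt hr), ← Complex.cpow_add _ _ hr0]
      congr 1
      ring
    rw [hpow, Complex.cpow_sub _ _ hr0, Complex.cpow_one, Complex.real_smul, Real.rpow_two,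
      show (2 : ℝ) - 1 = 1 by norm_num, Real.rpow_one]
    push_cast
    rw [show -(1 / 4 * (r : ℂ) ^ 2) = -((r : ℂ) ^ 2 / 4) by ring]
    field_simp
  rw [setIntegral_congr_fun measurableSet_Ioi hfun, integral_const_mul] at hΓ
  have h4 : (1 / ((1 / 4 : ℝ) : ℂ)) ^ ((s + 1) / 2) = 2 * 2 ^ s := by
    have h : (1 / ((1 / 4 : ℝ) : ℂ)) = ((2 : ℝ) : ℂ) * ((2 : ℝ) : ℂ) := by
      push_cast
      norm_num
    rw [h, Complex.mul_cpow_ofReal_nonneg two_pos.le two_pos.le, Complex.ofReal_ofNat,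
      ← Complex.cpow_add _ _ two_ne_zero, add_halves, Complex.cpow_add _ _ two_ne_zero,
      Complex.cpow_one, mul_comm]
  rw [h4, mul_assoc] at hΓ
  exact mul_left_cancel₀ two_ne_zero hΓ

/-- Convergence of the double integral, by comparison with a product of Gaussian moments. -/
theorem integrableOn_cpow_mul_cexp_neg_add_sq {s : ℂ} (hs : -1 < s.re) :
    IntegrableOn
      (fun q : ℝ × ℝ =>
        (q.1 : ℂ) ^ s * (q.2 : ℂ) * Complex.exp (-(((q.1 : ℂ) + (q.2 : ℂ)) ^ 2 / 4)))
      (Ioi (0 : ℝ) ×ˢ Ioi (0 : ℝ)) volume := by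
  have hS : MeasurableSet (Ioi (0 : ℝ) ×ˢ Ioi (0 : ℝ)) := measurableSet_Ioi.prod measurableSet_Ioi
  have hdom := (integrableOn_rpow_mul_exp_neg_mul_sq (b := 1 / 4) (by norm_num) hs).mul_prod
    (integrableOn_rpow_mul_exp_neg_mul_sq (b := 1 / 4) (by norm_num) (s := 1) (by norm_num))
  rw [Measure.prod_restrict, ← Measure.volume_eq_prod] at hdom
  refine hdom.mono' (by fun_prop) ((ae_restrict_iff' hS).2 (.of_forall ?_))
  rintro ⟨x, y⟩ ⟨hx, hy⟩
  have hx : 0 < x := hx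
  have hy : 0 < y := hy
  have hexp : ‖Complex.exp (-(((x : ℂ) + (y : ℂ)) ^ 2 / 4))‖ = Real.exp (-((x + y) ^ 2 / 4)) := by
    rw [Complex.norm_exp]
    norm_cast
  have hle : Real.exp (-((x + y) ^ 2 / 4)) ≤
      Real.exp (-(1 / 4) * x ^ 2) * Real.exp (-(1 / 4) * y ^ 2) := by
    rw [← Real.exp_add, Real.exp_le_exp]
    nlinarith [mul_pos hx hy]
  simp only [norm_mul, hexp, Complex.norm_cpow_eq_rpow_re_of_pos hx, Complex.norm_real,
    Real.norm_of_nonneg hy.le, Real.rpow_one]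
  calc x ^ s.re * y * Real.exp (-((x + y) ^ 2 / 4))
      ≤ x ^ s.re * y * (Real.exp (-(1 / 4) * x ^ 2) * Real.exp (-(1 / 4) * y ^ 2)) := by gcongr
    _ = _ := by ring

/-- The coefficient integral defining `ε₁₄,α` in Section 3.2 of the paper. -/
theorem stmt5 (α : ℂ) (hα : α.re < 1) :
    IntegrableOn
      (fun q : ℝ × ℝ =>
        (q.1 : ℂ) ^ (1 - α) * (q.2 : ℂ) * Complex.exp (-(((q.1 : ℂ) + (q.2 : ℂ)) ^ 2 / 4)))
      (Ioi (0 : ℝ) ×ˢ Ioi (0 : ℝ)) volume ∧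
    ∫ q in Ioi (0 : ℝ) ×ˢ Ioi (0 : ℝ),
        (q.1 : ℂ) ^ (1 - α) * (q.2 : ℂ) * Complex.exp (-(((q.1 : ℂ) + (q.2 : ℂ)) ^ 2 / 4))
      = 2 ^ (2 - α) * Complex.Gamma ((2 - α) / 2) / (3 - α) := by
  have hint := integrableOn_cpow_mul_cexp_neg_add_sq (s := 1 - α) (by simp; linarith)
  refine ⟨hint, ?_⟩
  have hs : 0 < (2 - α).re := by simp; linarith
  have hs0 : 2 - α ≠ 0 := fun h => by simp [h] at hs
  have hs1 : 3 - α ≠ 0 := fun h => by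
    have h' := congrArg Complex.re h
    simp at h'
    linarith
  have hinner : ∀ r ∈ Ioi (0 : ℝ),
      (∫ x in (0 : ℝ)..r, (x : ℂ) ^ (1 - α) * ((r - x : ℝ) : ℂ) *
        Complex.exp (-(((x : ℂ) + ((r - x : ℝ) : ℂ)) ^ 2 / 4))) =
      1 / ((2 - α) * (3 - α)) * ((r : ℂ) ^ (3 - α) * Complex.exp (-((r : ℂ) ^ 2 / 4))) := by
    intro r hr
    have hβ := Complex.betaIntegral_scaled (2 - α) 2 hr
    have hβ' := Complex.betaIntegral_eval_nat_add_one_right hs 1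
    rw [Finset.prod_range_succ, Finset.prod_range_one] at hβ'
    simp only [Nat.cast_one, Nat.cast_zero, Nat.factorial_one, add_zero, one_add_one_eq_two] at hβ'
    rw [hβ', show 2 - α - 1 = 1 - α by ring, show 2 - α + 2 - 1 = 3 - α by ring,
      show 2 - α + 1 = 3 - α by ring, show (2 : ℂ) - 1 = 1 by norm_num] at hβ
    simp only [Complex.cpow_one] at hβ
    simp only [Complex.ofReal_sub, add_sub_cancel, intervalIntegral.integral_mul_const, hβ]
    ring
  rw [setIntegral_quadrant_eq_integral_add hint, setIntegral_congr_fun measurableSet_Ioi hinner,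
    integral_const_mul, integral_cpow_mul_cexp_neg_sq_div_four (by simp; linarith),
    show (3 - α + 1) / 2 = (2 - α) / 2 + 1 by ring,
    Complex.Gamma_add_one _ (div_ne_zero hs0 two_ne_zero), show 3 - α = 2 - α + 1 by ring,
    Complex.cpow_add _ _ two_ne_zero, Complex.cpow_one]
  rw [show 3 - α = 2 - α + 1 by ring] at hs1
  field_simp
end

section
/- Let m ≥ 1, let B be a real symmetric positive-definite m×m matrix, let Q : ℂ^m → ℂ be the ℂ-bilinear extension of the quadratic form z ↦ zᵀ B z, let c ∈ ℝ^m, and let β = (β₁,…,β_m) be a multi-index of natural numbers. Then ∫_{ℝ^m} ∏_{k=1}^m (η_k + i c_k)^{β_k} · exp(−Q(η + i c)) dη = ∫_{ℝ^m} η^β exp(−ηᵀ B η) dη, both integrals being absolutely convergent. -/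
open MeasureTheory

section GaussianPolynomial

variable {ι : Type*} [Fintype ι]

/-- The real quadratic form of a matrix. -/
def realQuad (B : Matrix ι ι ℝ) (x : ι → ℝ) : ℝ := ∑ i, ∑ j, B i j * x i * x j

/-- The complex bilinear extension of the quadratic form of a real matrix. -/
def complexQuad (B : Matrix ι ι ℝ) (z : ι → ℂ) : ℂ := ∑ i, ∑ j, ((B i j : ℝ) : ℂ) * z i * z j

/-- A monomial times the complex Gaussian attached to a real matrix. -/
noncomputable def gaussMonomial (B : Matrix ι ι ℝ) (β : ι → ℕ) (z : ι → ℂ) : ℂ :=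
  (∏ k, z k ^ β k) * Complex.exp (-complexQuad B z)

lemma continuous_realQuad (B : Matrix ι ι ℝ) : Continuous (realQuad B) := by
  unfold realQuad; fun_prop

lemma continuous_gaussMonomial (B : Matrix ι ι ℝ) (β : ι → ℕ) :
    Continuous (gaussMonomial B β) := by
  unfold gaussMonomial complexQuad; fun_prop

lemma differentiable_gaussMonomial_line (B : Matrix ι ι ℝ) (β : ι → ℕ) (z w : ι → ℂ) :
    Differentiable ℂ (fun s : ℂ => gaussMonomial B β (fun k => z k + s * w k)) := by
  unfold gaussMonomial complexQuad
  fun_prop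

lemma realQuad_smul (B : Matrix ι ι ℝ) (r : ℝ) (x : ι → ℝ) :
    realQuad B (fun k => r * x k) = r ^ 2 * realQuad B x := by
  simp only [realQuad, Finset.mul_sum]
  refine Finset.sum_congr rfl fun i _ => Finset.sum_congr rfl fun j _ => ?_
  ring

lemma realQuad_pos {B : Matrix ι ι ℝ} (hB : B.PosDef) {x : ι → ℝ} (hx : x ≠ 0) :
    0 < realQuad B x := by
  have h := hB.dotProduct_mulVec_pos hx
  have e : realQuad B x = dotProduct (star x) (B.mulVec x) := by
    simp only [realQuad, dotProduct, Matrix.mulVec, Finset.mul_sum, Pi.star_apply, star_trivial]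
    refine Finset.sum_congr rfl fun i _ => Finset.sum_congr rfl fun j _ => ?_
    ring
  rwa [e]

lemma exists_pos_mul_sum_sq_le_realQuad {B : Matrix ι ι ℝ} (hB : B.PosDef) :
    ∃ l : ℝ, 0 < l ∧ ∀ x : ι → ℝ, l * ∑ k, x k ^ 2 ≤ realQuad B x := by
  obtain ⟨a, ha, h⟩ := (isCompact_sphere (0 : ι → ℝ) 1).exists_forall_le'
    (continuous_realQuad B).continuousOn (a := 0) (fun x hx => realQuad_pos hB (by
      rintro rfl
      simp at hx))
  refine ⟨a / (Fintype.card ι + 1), by positivity, fun x => ?_⟩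
  rcases eq_or_ne x 0 with rfl | hx
  · simp [realQuad]
  have hn : 0 < ‖x‖ := norm_pos_iff.2 hx
  have h1 := h (fun k => ‖x‖⁻¹ * x k) (by
    change ‖x‖⁻¹ • x ∈ _
    simp [norm_smul, hn.ne'])
  rw [realQuad_smul, inv_pow, inv_mul_eq_div, le_div_iff₀ (by positivity)] at h1
  have h2 : ∑ k, x k ^ 2 ≤ (Fintype.card ι + 1) * ‖x‖ ^ 2 := by
    have : ∑ k, x k ^ 2 ≤ ∑ _k : ι, ‖x‖ ^ 2 := by
      refine Finset.sum_le_sum fun k _ => ?_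
      have := norm_le_pi_norm x k
      rw [← sq_abs]
      exact pow_le_pow_left₀ (abs_nonneg _) this 2
    simp at this
    nlinarith [sq_nonneg ‖x‖]
  refine le_trans ?_ h1
  rw [div_mul_eq_mul_div, div_le_iff₀ (by positivity)]
  nlinarith

lemma re_complexQuad (B : Matrix ι ι ℝ) (z : ι → ℂ) :
    (complexQuad B z).re = realQuad B (fun k => (z k).re) - realQuad B (fun k => (z k).im) := by
  simp only [complexQuad, realQuad, Complex.re_sum, ← Finset.sum_sub_distrib]
  refine Finset.sum_congr rfl fun i _ => Finset.sum_congr rfl fun j _ => ?_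
  simp

lemma norm_gaussMonomial_le (B : Matrix ι ι ℝ) (β : ι → ℕ) (z : ι → ℂ) :
    ‖gaussMonomial B β z‖ ≤ Real.exp (∑ k, β k * ‖z k‖ - (complexQuad B z).re) := by
  rw [gaussMonomial, norm_mul, Complex.norm_exp, sub_eq_add_neg, Real.exp_add, Complex.neg_re,
    Real.exp_sum, norm_prod]
  gcongr with k
  rw [norm_pow, Real.exp_nat_mul]
  gcongr
  linarith [Real.add_one_le_exp ‖z k‖]

lemma exists_gaussMonomial_bound {B : Matrix ι ι ℝ} (hB : B.PosDef) (β : ι → ℕ)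
    (c : ι → ℝ) (R : ℝ) :
    ∃ a C : ℝ, 0 < a ∧ ∀ (s : ℂ), ‖s‖ ≤ R → ∀ η : ι → ℝ,
      ‖gaussMonomial B β (fun k => (η k : ℂ) + s * (c k : ℂ))‖ ≤
        C * Real.exp (-a * ∑ k, η k ^ 2) := by
  obtain ⟨l, hl, h⟩ := exists_pos_mul_sum_sq_le_realQuad hB
  refine ⟨l / 4, Real.exp (∑ k, (β k * (R * |c k|) + β k ^ 2 / l + l * (R ^ 2 * c k ^ 2)) +
    R ^ 2 * realQuad B c), by positivity, fun s hs η => ?_⟩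
  refine (norm_gaussMonomial_le _ _ _).trans ?_
  rw [← Real.exp_add, Real.exp_le_exp, re_complexQuad]
  have hre : s.re ^ 2 ≤ R ^ 2 := by
    rw [← sq_abs]
    exact pow_le_pow_left₀ (abs_nonneg _) ((Complex.abs_re_le_norm s).trans hs) 2
  have him : s.im ^ 2 ≤ R ^ 2 := by
    rw [← sq_abs]
    exact pow_le_pow_left₀ (abs_nonneg _) ((Complex.abs_im_le_norm s).trans hs) 2
  have hc : 0 ≤ realQuad B c :=
    (mul_nonneg hl.le (Finset.sum_nonneg fun k _ => sq_nonneg (c k))).trans (h c)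
  have h1 := h (fun k => η k + s.re * c k)
  have h2 : realQuad B (fun k => ((η k : ℂ) + s * (c k : ℂ)).im) ≤ R ^ 2 * realQuad B c := by
    simp only [Complex.add_im, Complex.ofReal_im, Complex.im_mul_ofReal, zero_add, realQuad_smul]
    gcongr
  simp only [Complex.add_re, Complex.ofReal_re, Complex.re_mul_ofReal]
  have h3 : ∑ k, β k * ‖(η k : ℂ) + s * (c k : ℂ)‖ ≤
      ∑ k, (β k * (R * |c k|) + β k ^ 2 / l + l * (R ^ 2 * c k ^ 2)) +
      -(l / 4) * ∑ k, η k ^ 2 + l * ∑ k, (η k + s.re * c k) ^ 2 := by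
    rw [Finset.mul_sum, Finset.mul_sum, ← Finset.sum_add_distrib, ← Finset.sum_add_distrib]
    refine Finset.sum_le_sum fun k _ => ?_
    have e1 : ‖(η k : ℂ) + s * (c k : ℂ)‖ ≤ |η k| + R * |c k| := by
      refine (norm_add_le _ _).trans ?_
      rw [norm_mul, Complex.norm_real, Complex.norm_real, Real.norm_eq_abs, Real.norm_eq_abs]
      gcongr
    have e2 : (β k : ℝ) * |η k| ≤ l / 4 * η k ^ 2 + β k ^ 2 / l := by
      have : l / 4 * η k ^ 2 + β k ^ 2 / l - β k * |η k| = (l * |η k| / 2 - β k) ^ 2 / l := by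
        rw [← sq_abs (η k)]
        field_simp
        ring
      have : 0 ≤ (l * |η k| / 2 - β k) ^ 2 / l := by positivity
      linarith
    have e3 : η k ^ 2 / 2 ≤ (η k + s.re * c k) ^ 2 + R ^ 2 * c k ^ 2 := by
      nlinarith [sq_nonneg (η k + 2 * (s.re * c k)),
        mul_le_mul_of_nonneg_right hre (sq_nonneg (c k))]
    have e4 := mul_le_mul_of_nonneg_left e1 (Nat.cast_nonneg (α := ℝ) (β k))
    have e5 := mul_le_mul_of_nonneg_left e3 hl.le
    linarith
  linarith

lemma integrable_exp_neg_mul_sum_sq {a : ℝ} (ha : 0 < a) :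
    Integrable (fun η : ι → ℝ => Real.exp (-a * ∑ k, η k ^ 2)) := by
  have h := (GaussianFourier.integrable_cexp_neg_mul_sum_add (ι := ι) (b := (a : ℂ))
    (by simpa using ha) 0).norm
  refine h.congr (Filter.Eventually.of_forall fun η => ?_)
  simp only [Complex.norm_exp]
  congr 1
  simp [← Complex.ofReal_pow, ← Complex.ofReal_sum]

lemma continuous_gaussMonomial_shift (B : Matrix ι ι ℝ) (β : ι → ℕ) (c : ι → ℝ) (s : ℂ) :
    Continuous (fun η : ι → ℝ => gaussMonomial B β (fun k => (η k : ℂ) + s * (c k : ℂ))) :=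
  (continuous_gaussMonomial B β).comp (by fun_prop)

lemma integrable_gaussMonomial_shift {B : Matrix ι ι ℝ} (hB : B.PosDef) (β : ι → ℕ)
    (c : ι → ℝ) (s : ℂ) :
    Integrable (fun η : ι → ℝ => gaussMonomial B β (fun k => (η k : ℂ) + s * (c k : ℂ))) := by
  obtain ⟨a, C, ha, h⟩ := exists_gaussMonomial_bound hB β c ‖s‖
  exact ((integrable_exp_neg_mul_sum_sq ha).const_mul C).mono'
    (continuous_gaussMonomial_shift B β c s).aestronglyMeasurable
    (Filter.Eventually.of_forall (h s le_rfl))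

lemma differentiable_integral_of_locally_dominated {E : Type*} [TopologicalSpace E]
    [SecondCountableTopology E] [MeasurableSpace E] [OpensMeasurableSpace E] {μ : Measure E}
    {F : E → ℂ → ℂ} (hF : Continuous (Function.uncurry F)) (hd : ∀ x, Differentiable ℂ (F x))
    (hdom : ∀ R : ℝ, ∃ g : E → ℝ, Integrable g μ ∧ ∀ s, ‖s‖ ≤ R → ∀ x, ‖F x s‖ ≤ g x) :
    Differentiable ℂ (fun s => ∫ x, F x s ∂μ) := by
  intro s₀
  obtain ⟨g, hg, h⟩ := hdom (‖s₀‖ + 2)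
  have hcont (s : ℂ) : AEStronglyMeasurable (fun x => F x s) μ :=
    (hF.comp (by fun_prop : Continuous fun x : E => (x, s))).aestronglyMeasurable
  have hmeas : AEStronglyMeasurable (fun x => deriv (F x) s₀) μ :=
    ((measurable_deriv_with_param hF).comp
      (measurable_prodMk_right (y := s₀))).aestronglyMeasurable
  have hint : Integrable (fun x => F x s₀) μ :=
    hg.mono' (hcont s₀) (Filter.Eventually.of_forall (h s₀ (by linarith)))
  refine (hasDerivAt_integral_of_dominated_loc_of_deriv_le (F := fun s x => F x s)
    (F' := fun s x => deriv (F x) s) (Metric.ball_mem_nhds s₀ one_pos) (bound := g)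
    (Filter.Eventually.of_forall hcont) hint hmeas
    (Filter.Eventually.of_forall fun x s hs => ?_) hg
    (Filter.Eventually.of_forall fun x s _ => (hd x s).hasDerivAt)).2.differentiableAt
  have := Complex.norm_deriv_le_of_forall_mem_sphere_norm_le (c := s) one_pos
    (hd x).diffContOnCl (C := g x) (fun w hw => h w ?_ x)
  · simpa using this
  · rw [mem_sphere_iff_norm] at hw
    rw [mem_ball_iff_norm] at hs
    have h1 : w = (w - s) + (s - s₀) + s₀ := by ring
    rw [h1]
    refine norm_add₃_le.trans ?_
    linarith

lemma differentiable_integral_gaussMonomial_shift {B : Matrix ι ι ℝ} (hB : B.PosDef)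
    (β : ι → ℕ) (c : ι → ℝ) :
    Differentiable ℂ (fun s : ℂ =>
      ∫ η : ι → ℝ, gaussMonomial B β (fun k => (η k : ℂ) + s * (c k : ℂ))) := by
  refine differentiable_integral_of_locally_dominated
    (F := fun (η : ι → ℝ) (s : ℂ) => gaussMonomial B β (fun k => (η k : ℂ) + s * (c k : ℂ)))
    ?_ (fun η => differentiable_gaussMonomial_line B β _ _) fun R => ?_
  · exact (continuous_gaussMonomial B β).comp
      (by fun_prop : Continuous fun (p : (ι → ℝ) × ℂ) k => (p.1 k : ℂ) + p.2 * (c k : ℂ))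
  · obtain ⟨a, C, ha, h⟩ := exists_gaussMonomial_bound hB β c R
    exact ⟨_, (integrable_exp_neg_mul_sum_sq ha).const_mul C, h⟩

lemma integral_gaussMonomial_shift_add_real (B : Matrix ι ι ℝ) (β : ι → ℕ) (c : ι → ℝ)
    (s : ℂ) (r : ℝ) :
    ∫ η : ι → ℝ, gaussMonomial B β (fun k => (η k : ℂ) + (s + r) * (c k : ℂ)) =
      ∫ η : ι → ℝ, gaussMonomial B β (fun k => (η k : ℂ) + s * (c k : ℂ)) := by
  rw [← integral_add_right_eq_self (fun η : ι → ℝ =>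
    gaussMonomial B β (fun k => (η k : ℂ) + s * (c k : ℂ))) (r • c)]
  congr! 4 with η k
  simp
  ring

theorem integral_gaussMonomial_shift {B : Matrix ι ι ℝ} (hB : B.PosDef) (β : ι → ℕ)
    (c : ι → ℝ) (s : ℂ) :
    ∫ η : ι → ℝ, gaussMonomial B β (fun k => (η k : ℂ) + s * (c k : ℂ)) =
      ∫ η : ι → ℝ, gaussMonomial B β (fun k => (η k : ℂ)) := by
  have hd := differentiable_integral_gaussMonomial_shift hB β c
  have key := is_const_of_deriv_eq_zero hd (fun s => ?_) s 0
  · simpa using key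
  have h1 := (((hd (s + (0 : ℝ))).hasDerivAt.comp_const_add s ((0 : ℝ) : ℂ))).comp_ofReal
  simp only [integral_gaussMonomial_shift_add_real] at h1
  simpa using h1.unique (hasDerivAt_const (0 : ℝ) _)

end GaussianPolynomial

/-- The contour-deformation step of Section 2.5 of the paper: the Gaussian-polynomial
integral over the shifted contour `ℝ^m + i c` equals the integral over `ℝ^m`. -/
theorem stmt10 (m : ℕ) (hm : 1 ≤ m)
    (B : Matrix (Fin m) (Fin m) ℝ) (hsym : B.IsSymm) (hpos : B.PosDef)
    (Q : (Fin m → ℂ) → ℂ)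
    (hQ : ∀ z : Fin m → ℂ, Q z = ∑ i, ∑ j, ((B i j : ℝ) : ℂ) * z i * z j)
    (c : Fin m → ℝ) (β : Fin m → ℕ) :
    Integrable (fun η : Fin m → ℝ =>
      (∏ k, ((η k : ℂ) + Complex.I * (c k : ℂ)) ^ β k) *
        Complex.exp (-Q (fun k => (η k : ℂ) + Complex.I * (c k : ℂ)))) ∧
    Integrable (fun η : Fin m → ℝ =>
      (∏ k, (η k : ℂ) ^ β k) * Complex.exp (-Q (fun k => (η k : ℂ)))) ∧
    ∫ η : Fin m → ℝ,
        (∏ k, ((η k : ℂ) + Complex.I * (c k : ℂ)) ^ β k) *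
          Complex.exp (-Q (fun k => (η k : ℂ) + Complex.I * (c k : ℂ)))
      = ∫ η : Fin m → ℝ,
          (∏ k, (η k : ℂ) ^ β k) * Complex.exp (-Q (fun k => (η k : ℂ))) := by
  obtain rfl : Q = complexQuad B := funext hQ
  have h1 := integrable_gaussMonomial_shift hpos β c Complex.I
  have h0 := integrable_gaussMonomial_shift hpos β 0 0
  simp only [Pi.zero_apply, Complex.ofReal_zero, mul_zero, add_zero] at h0
  exact ⟨h1, h0, integral_gaussMonomial_shift hpos β c Complex.I⟩
end
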